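/- arXiv:1010.4615 — 6 statements merged into one kernel-verified Lean document; each statement's English description precedes it below -/
import Mathlib

section
/- Let r(t) = a₁t² + a₂t + a₃ be a planar quadratic parametric curve with a₁ × a₂ ≠ 0 and signed curvature κ. Then the bending energy over the whole real line equals E = ∫_ℝ κ(t)² dt = (3π/4) · |a₁|⁴ / |a₁ × a₂|³. -/
open Real MeasureTheory

theorem hasDerivAt_primitive_inv_one_add_sq_cube (x : ℝ) :
    HasDerivAt (fun x : ℝ => (x / (4 * (1 + x ^ 2) ^ 2) + 3 * x / (8 * (1 + x ^ 2)))
      + 3 / 8 * arctan x) (((1 + x ^ 2) ^ 3)⁻¹) x := by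
  have hpos : 1 + x ^ 2 ≠ 0 := by positivity
  have hq : HasDerivAt (fun x : ℝ => 1 + x ^ 2) (2 * x) x := by
    simpa using (hasDerivAt_pow 2 x).const_add 1
  have h₁ := (hasDerivAt_id x).div ((hq.pow 2).const_mul 4)
    (mul_ne_zero four_ne_zero (pow_ne_zero 2 hpos))
  have h₂ := ((hasDerivAt_id x).const_mul 3).div (hq.const_mul 8)
    (mul_ne_zero (by norm_num) hpos)
  refine ((h₁.add h₂).add ((hasDerivAt_arctan x).const_mul (3 / 8))).congr_deriv ?_
  simp only [id, Pi.pow_apply]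
  field_simp
  ring

theorem tendsto_rational_part_zero {l : Filter ℝ}
    (hl : Filter.Tendsto (fun x : ℝ => |x|) l Filter.atTop) :
    Filter.Tendsto (fun x : ℝ => x / (4 * (1 + x ^ 2) ^ 2) + 3 * x / (8 * (1 + x ^ 2)))
      l (nhds 0) := by
  refine squeeze_zero_norm (fun x => ?_) (tendsto_inv_atTop_zero.comp hl)
  rcases eq_or_ne x 0 with rfl | hx
  · simp
  have hx' : 0 < |x| := abs_pos.mpr hx
  have hform : x / (4 * (1 + x ^ 2) ^ 2) + 3 * x / (8 * (1 + x ^ 2))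
      = x * ((5 + 3 * x ^ 2) / (8 * (1 + x ^ 2) ^ 2)) := by
    field_simp
    ring
  rw [hform, Real.norm_eq_abs, abs_mul,
    abs_of_nonneg (by positivity : 0 ≤ (5 + 3 * x ^ 2) / (8 * (1 + x ^ 2) ^ 2)),
    Function.comp_apply, ← mul_div_assoc, inv_eq_one_div,
    div_le_div_iff₀ (by positivity) hx']
  nlinarith [sq_abs x, sq_nonneg (x ^ 2), sq_nonneg x]

theorem integrable_inv_one_add_sq_cube :
    Integrable fun x : ℝ => ((1 + x ^ 2) ^ 3)⁻¹ := by
  refine integrable_inv_one_add_sq.mono' (by fun_prop) (Filter.Eventually.of_forall fun x => ?_)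
  rw [Real.norm_of_nonneg (by positivity)]
  have h : 1 ≤ 1 + x ^ 2 := by nlinarith [sq_nonneg x]
  exact inv_anti₀ (by positivity) (le_self_pow₀ h three_ne_zero)

theorem integral_inv_one_add_sq_cube :
    ∫ x : ℝ, ((1 + x ^ 2) ^ 3)⁻¹ = 3 * π / 8 := by
  have hbot := (tendsto_rational_part_zero Filter.tendsto_abs_atBot_atTop).add
    ((tendsto_arctan_atBot.mono_right nhdsWithin_le_nhds).const_mul (3 / 8))
  have htop := (tendsto_rational_part_zero Filter.tendsto_abs_atTop_atTop).add
    ((tendsto_arctan_atTop.mono_right nhdsWithin_le_nhds).const_mul (3 / 8))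
  rw [integral_of_hasDerivAt_of_tendsto hasDerivAt_primitive_inv_one_add_sq_cube
    integrable_inv_one_add_sq_cube hbot htop]
  ring

theorem deriv_quadratic (a b c : ℝ) :
    deriv (fun t : ℝ => a * t ^ 2 + b * t + c) = fun t => 2 * a * t + b := by
  funext t
  refine HasDerivAt.deriv ?_
  refine ((((hasDerivAt_pow 2 t).const_mul a).add
    ((hasDerivAt_id t).const_mul b)).add_const c).congr_deriv ?_
  norm_num
  ring

theorem deriv_affine (a b : ℝ) :
    deriv (fun t : ℝ => a * t + b) = fun _ => a := by
  funext t
  simp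

/-- For a planar quadratic parametric curve `r(t) = a₁ t² + a₂ t + a₃` with
`a₁ = (x₁, y₁)`, `a₂ = (x₂, y₂)`, `a₃ = (x₃, y₃)` and `a₁ × a₂ ≠ 0`, the
bending energy over the whole real line equals
`(3π/4) · |a₁|⁴ / |a₁ × a₂|³`, where `|a₁|` is the Euclidean norm. -/
theorem energy_of_quadratic
    (x₁ y₁ x₂ y₂ x₃ y₃ : ℝ)
    (x y : ℝ → ℝ)
    (hx : x = fun t => x₁ * t ^ 2 + x₂ * t + x₃)
    (hy : y = fun t => y₁ * t ^ 2 + y₂ * t + y₃)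
    (hcross : x₁ * y₂ - y₁ * x₂ ≠ 0)
    (κ : ℝ → ℝ)
    (hκ : κ = fun t =>
      (deriv x t * deriv (deriv y) t - deriv y t * deriv (deriv x) t) /
        ((deriv x t) ^ 2 + (deriv y t) ^ 2) ^ ((3 : ℝ) / 2)) :
    ∫ t : ℝ, (κ t) ^ 2 =
      (3 * π / 4) * (Real.sqrt (x₁ ^ 2 + y₁ ^ 2)) ^ 4 / |x₁ * y₂ - y₁ * x₂| ^ 3 := by
  have hA : 0 < x₁ ^ 2 + y₁ ^ 2 := by
    by_contra hneg
    have hx₁ : x₁ = 0 := by nlinarith [sq_nonneg x₁, sq_nonneg y₁]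
    have hy₁ : y₁ = 0 := by nlinarith [sq_nonneg x₁, sq_nonneg y₁]
    exact hcross (by simp [hx₁, hy₁])
  set A := x₁ ^ 2 + y₁ ^ 2 with hAdef
  set c := x₁ * y₂ - y₁ * x₂ with hcdef
  have hc : 0 < |c| := abs_pos.mpr hcross
  set m := 2 * A / |c| with hm
  set b := (x₁ * x₂ + y₁ * y₂) / |c| with hb
  have hm_pos : 0 < m := by positivity
  have hκsq : ∀ t, κ t ^ 2 = 4 * A ^ 3 / |c| ^ 4 * ((1 + (m * t + b) ^ 2) ^ 3)⁻¹ := by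
    intro t
    have hQ : (2 * x₁ * t + x₂) ^ 2 + (2 * y₁ * t + y₂) ^ 2
        = |c| ^ 2 / A * (1 + (m * t + b) ^ 2) := by
      have hcm : |c| ^ 2 * (1 + (m * t + b) ^ 2)
          = c ^ 2 + (2 * A * t + (x₁ * x₂ + y₁ * y₂)) ^ 2 := by
        rw [← sq_abs c, hm, hb]
        field_simp
      rw [div_mul_eq_mul_div, hcm, eq_div_iff hA.ne', hcdef, hAdef]
      ring
    have hpow : (((2 * x₁ * t + x₂) ^ 2 + (2 * y₁ * t + y₂) ^ 2) ^ ((3 : ℝ) / 2)) ^ 2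
        = ((2 * x₁ * t + x₂) ^ 2 + (2 * y₁ * t + y₂) ^ 2) ^ 3 := by
      rw [← Real.rpow_natCast, ← Real.rpow_mul (by positivity), ← Real.rpow_natCast]
      norm_num
    have hnum : (2 * x₁ * t + x₂) * (2 * y₁) - (2 * y₁ * t + y₂) * (2 * x₁) = -2 * c := by
      rw [hcdef]
      ring
    simp only [hκ, hx, hy, deriv_quadratic, deriv_affine]
    rw [div_pow, hpow, hQ, hnum, mul_pow, ← sq_abs c]
    field_simp
    norm_num
  simp_rw [hκsq]
  rw [integral_const_mul,
    Measure.integral_comp_mul_left (fun s : ℝ => ((1 + (s + b) ^ 2) ^ 3)⁻¹) m,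
    integral_add_right_eq_self (fun s : ℝ => ((1 + s ^ 2) ^ 3)⁻¹) b,
    integral_inv_one_add_sq_cube, abs_of_pos (inv_pos.mpr hm_pos), smul_eq_mul,
    show √A ^ 4 = (√A ^ 2) ^ 2 by ring, Real.sq_sqrt hA.le, hm]
  field_simp
  norm_num
end

section
/- Let a, b, c ∈ ℝ with a ≠ 0 and consider the parabola parametrized as r(t) = (t, at² + bt + c), whose signed curvature is κ(t) = 2a[1 + (2at + b)²]^{−3/2}, with derivative κ̇(t) = −12a²(2at + b)[1 + (2at + b)²]^{−5/2}. Then the curvature variation over the whole real line equals V = ∫_ℝ κ̇(t)² dt = (45π/16)|a|³. -/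
open Real MeasureTheory

/-- The rational part of an antiderivative of `u² / (1 + u²)⁵` vanishes at infinity. -/
lemma tendsto_rational_part {l : Filter ℝ}
    (hl : Filter.Tendsto (fun u : ℝ => u⁻¹) l (nhds 0)) :
    Filter.Tendsto (fun u : ℝ => u / (1 + u ^ 2) *
      (5 / 128 + 5 / 192 * (1 + u ^ 2)⁻¹ + 1 / 48 * (1 + u ^ 2)⁻¹ ^ 2
        - 1 / 8 * (1 + u ^ 2)⁻¹ ^ 3)) l (nhds 0) := by
  refine squeeze_zero_norm (a := fun u : ℝ => |u⁻¹| * 1) (fun u => ?_) (by simpa using hl.abs)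
  have hw : (0 : ℝ) < 1 + u ^ 2 := by positivity
  have h0 : 0 ≤ (1 + u ^ 2)⁻¹ := by positivity
  have h1 : (1 + u ^ 2)⁻¹ ≤ 1 := inv_le_one_of_one_le₀ (by nlinarith [sq_nonneg u])
  rw [norm_mul, Real.norm_eq_abs, Real.norm_eq_abs]
  refine mul_le_mul ?_ ?_ (abs_nonneg _) (abs_nonneg _)
  · rw [abs_div, abs_inv, abs_of_pos hw]
    rcases eq_or_ne u 0 with rfl | hu
    · simp
    · have := abs_pos.mpr hu
      rw [div_le_iff₀ hw, ← sq_abs]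
      field_simp
      linarith
  · have h2 := pow_le_one₀ (n := 2) h0 h1
    have h3 := pow_le_one₀ (n := 3) h0 h1
    have h2' := pow_nonneg h0 2
    have h3' := pow_nonneg h0 3
    rw [abs_le]
    constructor <;> linarith

lemma integral_sq_div_one_add_sq_pow_five :
    ∫ u : ℝ, u ^ 2 / (1 + u ^ 2) ^ 5 = 5 * π / 128 := by
  have hderiv (u : ℝ) : HasDerivAt (fun u : ℝ => 5 / 128 * arctan u + u / (1 + u ^ 2) *
      (5 / 128 + 5 / 192 * (1 + u ^ 2)⁻¹ + 1 / 48 * (1 + u ^ 2)⁻¹ ^ 2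
        - 1 / 8 * (1 + u ^ 2)⁻¹ ^ 3)) (u ^ 2 / (1 + u ^ 2) ^ 5) u := by
    have hw : 1 + u ^ 2 ≠ 0 := by positivity
    have hd : HasDerivAt (fun u : ℝ => 1 + u ^ 2) (2 * u) u := by
      simpa using (hasDerivAt_pow 2 u).const_add 1
    have hi := hd.fun_inv hw
    refine HasDerivAt.congr_deriv (((hasDerivAt_arctan u).const_mul (5 / 128)).fun_add
      (((hasDerivAt_id' u).fun_div hd hw).fun_mul
        ((((hi.const_mul (5 / 192)).const_add (5 / 128)).fun_add
          ((hi.fun_pow 2).const_mul (1 / 48))).fun_sub ((hi.fun_pow 3).const_mul (1 / 8))))) ?_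
    simp only [Nat.reduceSub]
    field_simp
    ring
  have h_integrable : Integrable (fun u : ℝ => u ^ 2 / (1 + u ^ 2) ^ 5) := by
    refine integrable_inv_one_add_sq.mono' (Measurable.aestronglyMeasurable (by fun_prop)) (ae_of_all _ fun u => ?_)
    have hw : (0 : ℝ) < 1 + u ^ 2 := by positivity
    have h1 : 1 ≤ (1 + u ^ 2) ^ 3 := one_le_pow₀ (by nlinarith [sq_nonneg u])
    rw [Real.norm_of_nonneg (by positivity), div_le_iff₀ (by positivity)]
    have he : (1 + u ^ 2)⁻¹ * (1 + u ^ 2) ^ 5 = (1 + u ^ 2) * (1 + u ^ 2) ^ 3 := by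
      field_simp
    rw [he]
    nlinarith [sq_nonneg u]
  have hbot := ((tendsto_arctan_atBot.mono_right nhdsWithin_le_nhds).const_mul (5 / 128)).add
    (tendsto_rational_part tendsto_inv_atBot_zero)
  have htop := ((tendsto_arctan_atTop.mono_right nhdsWithin_le_nhds).const_mul (5 / 128)).add
    (tendsto_rational_part tendsto_inv_atTop_zero)
  rw [integral_of_hasDerivAt_of_tendsto hderiv h_integrable hbot htop]
  ring

/-- For the parabola `r(t) = (t, at² + bt + c)` with `a ≠ 0`, whose signed
curvature is `κ(t) = 2a(1 + (2at + b)²)^(−3/2)` with derivative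
`κ̇(t) = −12a²(2at + b)(1 + (2at + b)²)^(−5/2)`, the curvature variation over
the whole real line equals `(45π/16)|a|³`. -/
theorem curvature_variation_of_parabola
    (a b c : ℝ) (ha : a ≠ 0)
    (κ κ' : ℝ → ℝ)
    (hκ : κ = fun t => 2 * a * (1 + (2 * a * t + b) ^ 2) ^ (-(3 : ℝ) / 2))
    (hκ' : κ' = fun t =>
      -12 * a ^ 2 * (2 * a * t + b) * (1 + (2 * a * t + b) ^ 2) ^ (-(5 : ℝ) / 2))
    (hderiv : deriv κ = κ') :
    ∫ t : ℝ, (κ' t) ^ 2 = (45 * π / 16) * |a| ^ 3 := by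
  have hsq (t : ℝ) : κ' t ^ 2 = 144 * a ^ 4 *
      ((2 * a * t + b) ^ 2 / (1 + (2 * a * t + b) ^ 2) ^ 5) := by
    have hw : (0 : ℝ) ≤ 1 + (2 * a * t + b) ^ 2 := by positivity
    have hp : ((1 + (2 * a * t + b) ^ 2) ^ (-(5 : ℝ) / 2)) ^ 2
        = ((1 + (2 * a * t + b) ^ 2) ^ 5)⁻¹ := by
      rw [← rpow_mul_natCast hw, ← rpow_natCast _ 5, ← rpow_neg hw]
      norm_num
    simp only [hκ', mul_pow, hp]
    ring
  simp_rw [hsq]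
  rw [integral_const_mul,
    Measure.integral_comp_mul_left (fun x : ℝ => (x + b) ^ 2 / (1 + (x + b) ^ 2) ^ 5) (2 * a),
    integral_add_right_eq_self (fun u : ℝ => u ^ 2 / (1 + u ^ 2) ^ 5) b,
    integral_sq_div_one_add_sq_pow_five, abs_inv, abs_mul, abs_two, smul_eq_mul,
    ← (show Even 4 by decide).pow_abs a]
  have := abs_pos.mpr ha
  field_simp
  norm_num
end

section
/- (Lemma: a quadratic of least energy also has least curvature variation.) Let a, b, c, a′, b′, c′ ∈ ℝ with a ≠ 0 and a′ ≠ 0, and consider the two parabolas r(t) = (t, at² + bt + c) and r′(t) = (t, a′t² + b′t + c′), with signed curvatures κ(t) = 2a[1 + (2at + b)²]^{−3/2} and κ′(t) = 2a′[1 + (2a′t + b′)²]^{−3/2}. If ∫_ℝ κ(t)² dt ≤ ∫_ℝ κ′(t)² dt, then ∫_ℝ κ̇(t)² dt ≤ ∫_ℝ κ̇′(t)² dt. -/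
open Real MeasureTheory

theorem integral_sq_const_mul_comp_affine (g : ℝ → ℝ) (k m b : ℝ) :
    ∫ t : ℝ, (k * g (m * t + b)) ^ 2 = k ^ 2 * |m⁻¹| * ∫ u : ℝ, g u ^ 2 := by
  simp_rw [mul_pow]
  rw [integral_const_mul, Measure.integral_comp_mul_left (fun s => g (s + b) ^ 2) m,
    integral_add_right_eq_self (fun u => g u ^ 2) b, smul_eq_mul, mul_assoc]

theorem deriv_const_mul_comp_affine (g : ℝ → ℝ) (m b : ℝ) :
    deriv (fun t => m * g (m * t + b)) = fun t => m ^ 2 * deriv g (m * t + b) := by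
  funext t
  rw [deriv_const_mul_field, deriv_comp_mul_left m (fun s => g (s + b)) t,
    deriv_comp_add_const, smul_eq_mul]
  ring

theorem sq_mul_abs_inv (m : ℝ) : m ^ 2 * |m⁻¹| = |m| := by
  rcases eq_or_ne m 0 with rfl | hm
  · simp
  · have : |m| ≠ 0 := abs_ne_zero.mpr hm
    rw [abs_inv, ← sq_abs m]
    field_simp

theorem integral_sq_one_add_sq_rpow_pos :
    0 < ∫ u : ℝ, ((1 + u ^ 2) ^ (-(3 : ℝ) / 2)) ^ 2 := by
  have hpos (u : ℝ) : 0 < 1 + u ^ 2 := by positivity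
  have hcont : Continuous fun u : ℝ => ((1 + u ^ 2) ^ (-(3 : ℝ) / 2)) ^ 2 :=
    ((by fun_prop : Continuous fun u : ℝ => 1 + u ^ 2).rpow_const
      fun u => Or.inl (hpos u).ne').pow 2
  have hint : Integrable fun u : ℝ => ((1 + u ^ 2) ^ (-(3 : ℝ) / 2)) ^ 2 := by
    refine integrable_inv_one_add_sq.mono' hcont.aestronglyMeasurable (.of_forall fun u => ?_)
    rw [norm_of_nonneg (by positivity), ← rpow_mul_natCast (hpos u).le, ← rpow_neg_one]
    exact rpow_le_rpow_of_exponent_le (by nlinarith [sq_nonneg u]) (by norm_num)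
  exact integral_pos_of_integrable_nonneg_nonzero (x := 0) hcont hint
    (fun u => by positivity) (by simp)

/-- A quadratic (parabola) of least bending energy also has least curvature
variation: for two parabolas `r(t) = (t, at² + bt + c)` and
`r'(t) = (t, a't² + b't + c')` with `a ≠ 0`, `a' ≠ 0` and signed curvatures
`κ`, `κ'`, if `∫ κ² ≤ ∫ κ'²` then `∫ κ̇² ≤ ∫ κ̇'²`. -/
theorem min_energy_implies_min_curvature_variation
    (a b c a' b' c' : ℝ) (ha : a ≠ 0) (ha' : a' ≠ 0)
    (κ κ' : ℝ → ℝ)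
    (hκ : κ = fun t => 2 * a * (1 + (2 * a * t + b) ^ 2) ^ (-(3 : ℝ) / 2))
    (hκ' : κ' = fun t => 2 * a' * (1 + (2 * a' * t + b') ^ 2) ^ (-(3 : ℝ) / 2))
    (hE : (∫ t : ℝ, (κ t) ^ 2) ≤ ∫ t : ℝ, (κ' t) ^ 2) :
    (∫ t : ℝ, (deriv κ t) ^ 2) ≤ ∫ t : ℝ, (deriv κ' t) ^ 2 := by
  let g : ℝ → ℝ := fun u => (1 + u ^ 2) ^ (-(3 : ℝ) / 2)
  have hG : 0 < ∫ u : ℝ, g u ^ 2 := integral_sq_one_add_sq_rpow_pos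
  have energy (m b : ℝ) :
      ∫ t : ℝ, (m * g (m * t + b)) ^ 2 = |m| * ∫ u : ℝ, g u ^ 2 := by
    rw [integral_sq_const_mul_comp_affine, sq_mul_abs_inv]
  have variation (m b : ℝ) :
      ∫ t : ℝ, (deriv (fun t => m * g (m * t + b)) t) ^ 2 =
        |m| ^ 3 * ∫ u : ℝ, deriv g u ^ 2 := by
    rw [deriv_const_mul_comp_affine, integral_sq_const_mul_comp_affine (deriv g),
      show (m ^ 2) ^ 2 * |m⁻¹| = m ^ 2 * (m ^ 2 * |m⁻¹|) by ring, sq_mul_abs_inv, ← sq_abs m]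
    ring
  have hκg : κ = fun t => 2 * a * g (2 * a * t + b) := hκ
  have hκg' : κ' = fun t => 2 * a' * g (2 * a' * t + b') := hκ'
  rw [hκg, hκg', energy, energy] at hE
  rw [hκg, hκg', variation, variation]
  have hle : |2 * a| ≤ |2 * a'| := le_of_mul_le_mul_right hE hG
  gcongr
end

section
/- Let q₂ = (q₂ₓ, q₂ᵧ) ∈ ℝ² with q₂ᵧ ≠ 0, let q₃ = (1, 0), and let T ∈ ℝ with T ≠ 0 and T ≠ 1. Then the derivative with respect to T of the function T ↦ [(q₂ − q₃T)·(q₂ − q₃T)]² / (T² − T) vanishes at T if and only if T satisfies the cubic equation T³ − (3/2)T² + (q₂ₓ − |q₂|²)T + (1/2)|q₂|² = 0. -/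
/-- For `q₂ = (q₂ₓ, q₂ᵧ)` with `q₂ᵧ ≠ 0`, `q₃ = (1,0)` and `T ∉ {0, 1}`, the
derivative of `T ↦ ((q₂ − q₃T)·(q₂ − q₃T))² / (T² − T)` vanishes at `T` iff
`T³ − (3/2)T² + (q₂ₓ − |q₂|²)T + (1/2)|q₂|² = 0`. -/
theorem energy_stationary_iff_cubic
    (q₂ : ℝ × ℝ) (hy : q₂.2 ≠ 0)
    (q₃ : ℝ × ℝ) (hq₃ : q₃ = ((1 : ℝ), (0 : ℝ)))
    (T : ℝ) (hT0 : T ≠ 0) (hT1 : T ≠ 1)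
    (f : ℝ → ℝ)
    (hf : f = fun S =>
      ((q₂ - S • q₃).1 * (q₂ - S • q₃).1 + (q₂ - S • q₃).2 * (q₂ - S • q₃).2) ^ 2 /
        (S ^ 2 - S)) :
    deriv f T = 0 ↔
      T ^ 3 - (3 / 2) * T ^ 2 + (q₂.1 - (q₂.1 ^ 2 + q₂.2 ^ 2)) * T +
        (1 / 2) * (q₂.1 ^ 2 + q₂.2 ^ 2) = 0 := by
  obtain ⟨a, b⟩ := q₂
  subst hq₃ hf
  dsimp only at hy ⊢
  have hD : T ^ 2 - T ≠ 0 := by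
    have h : T ^ 2 - T = T * (T - 1) := by ring
    rw [h]
    exact mul_ne_zero hT0 (sub_ne_zero.mpr hT1)
  have hN : (a - T) ^ 2 + b ^ 2 ≠ 0 := by positivity
  have hfun : (fun S : ℝ =>
      ((((a, b) : ℝ × ℝ) - S • ((1 : ℝ), (0 : ℝ))).1 * (((a, b) : ℝ × ℝ) - S • ((1 : ℝ), (0 : ℝ))).1 +
        (((a, b) : ℝ × ℝ) - S • ((1 : ℝ), (0 : ℝ))).2 * (((a, b) : ℝ × ℝ) - S • ((1 : ℝ), (0 : ℝ))).2) ^ 2 /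
        (S ^ 2 - S)) = fun S => ((a - S) ^ 2 + b ^ 2) ^ 2 / (S ^ 2 - S) := by
    funext S
    simp [sq]
  have hnum : HasDerivAt (fun S : ℝ => ((a - S) ^ 2 + b ^ 2) ^ 2)
      (4 * ((a - T) ^ 2 + b ^ 2) * (T - a)) T := by
    refine (((((hasDerivAt_id' T).const_sub a).fun_pow 2).add_const (b ^ 2)).fun_pow 2).congr_deriv ?_
    push_cast
    ring
  have hden : HasDerivAt (fun S : ℝ => S ^ 2 - S) (2 * T - 1) T := by
    simpa using (hasDerivAt_pow 2 T).fun_sub (hasDerivAt_id' T)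
  have hquot : 4 * ((a - T) ^ 2 + b ^ 2) * (T - a) * (T ^ 2 - T) -
      ((a - T) ^ 2 + b ^ 2) ^ 2 * (2 * T - 1) =
      2 * ((a - T) ^ 2 + b ^ 2) *
        (T ^ 3 - (3 / 2) * T ^ 2 + (a - (a ^ 2 + b ^ 2)) * T + (1 / 2) * (a ^ 2 + b ^ 2)) := by
    ring
  rw [hfun, (hnum.fun_div hden hD).deriv, hquot, div_eq_zero_iff,
    or_iff_left (pow_ne_zero 2 hD), mul_eq_zero, or_iff_right (mul_ne_zero two_ne_zero hN)]
end

section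
/- Let q₂ = (q₂ₓ, q₂ᵧ) ∈ ℝ² with q₂ᵧ ≠ 0. Then the cubic polynomial p(T) = T³ − (3/2)T² + (q₂ₓ − |q₂|²)T + (1/2)|q₂|² has three real roots T₁ < T₂ < T₃ satisfying T₁ < 0 < T₂ < 1 < T₃. -/
/-- For `q₂ = (q₂ₓ, q₂ᵧ)` with `q₂ᵧ ≠ 0`, the cubic
`p(T) = T³ − (3/2)T² + (q₂ₓ − |q₂|²)T + (1/2)|q₂|²` has three real roots
`T₁ < T₂ < T₃` with `T₁ < 0 < T₂ < 1 < T₃`. -/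
theorem cubic_has_three_real_roots
    (q₂x q₂y : ℝ) (hy : q₂y ≠ 0)
    (p : ℝ → ℝ)
    (hp : p = fun T =>
      T ^ 3 - (3 / 2) * T ^ 2 + (q₂x - (q₂x ^ 2 + q₂y ^ 2)) * T +
        (1 / 2) * (q₂x ^ 2 + q₂y ^ 2)) :
    ∃ T₁ T₂ T₃ : ℝ, T₁ < T₂ ∧ T₂ < T₃ ∧
      T₁ < 0 ∧ 0 < T₂ ∧ T₂ < 1 ∧ 1 < T₃ ∧
      p T₁ = 0 ∧ p T₂ = 0 ∧ p T₃ = 0 := by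
  have hcont : Continuous p := by rw [hp]; fun_prop
  have hy2 : 0 < q₂y ^ 2 := by positivity
  obtain ⟨s, hs⟩ : ∃ s, s = q₂x ^ 2 + q₂y ^ 2 := ⟨_, rfl⟩
  have hs0 : 0 < s := by rw [hs]; positivity
  have hx_upper : q₂x ≤ 1 / 2 + s / 2 := by nlinarith [sq_nonneg (q₂x - 1)]
  have hx_lower : -(1 / 2 + s / 2) ≤ q₂x := by nlinarith [sq_nonneg (q₂x + 1)]
  have hzero : 0 < p 0 := by
    simp only [hp, ← hs]
    linarith
  have hone : p 1 < 0 := by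
    simp only [hp]
    nlinarith [sq_nonneg (q₂x - 1)]
  have hright : 0 < p (2 + s) := by
    have hfactor : 0 < (2 + s) * ((2 + s) * (1 / 2 + s) + (q₂x - s)) :=
      mul_pos (by linarith) (by nlinarith)
    simp only [hp, ← hs]
    linarith
  have hleft : p (-(2 + s)) < 0 := by
    have hfactor : 0 < (2 + s) * ((2 + s) * (7 / 2 + s) + (q₂x - s) - 1 / 2) :=
      mul_pos (by linarith) (by nlinarith)
    simp only [hp, ← hs]
    linarith
  obtain ⟨T₁, ⟨-, h₁⟩, hT₁⟩ :=
    intermediate_value_Ioo (by linarith : -(2 + s) ≤ 0) hcont.continuousOn ⟨hleft, hzero⟩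
  obtain ⟨T₂, ⟨h₂, h₂'⟩, hT₂⟩ :=
    intermediate_value_Ioo' (zero_le_one' ℝ) hcont.continuousOn ⟨hone, hzero⟩
  obtain ⟨T₃, ⟨h₃, -⟩, hT₃⟩ :=
    intermediate_value_Ioo (by linarith : 1 ≤ 2 + s) hcont.continuousOn ⟨hone, hright⟩
  exact ⟨T₁, T₂, T₃, h₁.trans h₂, h₂'.trans h₃, h₁, h₂, h₂', h₃, hT₁, hT₂, hT₃⟩
end

section
/- Let r₁, r₂ ∈ ℝ² with r₁ × r₂ ≠ 0 (in particular r₁ ≠ 0 and r₂ ≠ 0). Let cos θ = (r₁·r₂)/(|r₁||r₂|), sin²θ = 1 − cos²θ, and ρ = √(4|r₁|² − 4|r₁||r₂|cos θ + |r₂|²). Then ∫₀¹ |2t·r₁ − r₂| dt = (1/(4|r₁|)) · [ |r₂|² cos θ + (2|r₁| − |r₂| cos θ)·ρ + |r₂|² sin²θ · log( (2|r₁| − |r₂| cos θ + ρ) / (|r₂|(1 − cos θ)) ) ]. -/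
open MeasureTheory

theorem add_sqrt_sq_add_pos {k : ℝ} (hk : 0 < k) (u : ℝ) : 0 < u + Real.sqrt (u ^ 2 + k) := by
  have h : |u| < Real.sqrt (u ^ 2 + k) := by
    rw [← Real.sqrt_sq_eq_abs]
    exact Real.sqrt_lt_sqrt (sq_nonneg u) (by linarith)
  linarith [neg_abs_le u]

theorem hasDerivAt_sqrt_sq_add_primitive {k : ℝ} (hk : 0 < k) (u : ℝ) :
    HasDerivAt (fun u : ℝ => (u * Real.sqrt (u ^ 2 + k) +
      k * Real.log (u + Real.sqrt (u ^ 2 + k))) / 2) (Real.sqrt (u ^ 2 + k)) u := by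
  have hpos : 0 < u ^ 2 + k := by positivity
  have hs : 0 < Real.sqrt (u ^ 2 + k) := Real.sqrt_pos.2 hpos
  have hsq : Real.sqrt (u ^ 2 + k) ^ 2 = u ^ 2 + k := Real.sq_sqrt hpos.le
  have hlog := add_sqrt_sq_add_pos hk u
  have h₁ : HasDerivAt (fun u : ℝ => Real.sqrt (u ^ 2 + k))
      (2 * u / (2 * Real.sqrt (u ^ 2 + k))) u := by
    have h := ((hasDerivAt_pow 2 u).add_const k).sqrt hpos.ne'
    simpa using h
  have h₂ := ((hasDerivAt_id u).add h₁).log hlog.ne'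
  refine ((((hasDerivAt_id u).mul h₁).add (h₂.const_mul k)).div_const 2).congr_deriv ?_
  simp only [id, Pi.add_apply]
  generalize Real.sqrt (u ^ 2 + k) = s at *
  have hk' : k = s ^ 2 - u ^ 2 := by linarith
  subst hk'
  field_simp
  ring

theorem integral_sqrt_sq_add {k : ℝ} (hk : 0 < k) (a b : ℝ) :
    ∫ u in a..b, Real.sqrt (u ^ 2 + k) =
      (b * Real.sqrt (b ^ 2 + k) + k * Real.log (b + Real.sqrt (b ^ 2 + k))) / 2 -
        (a * Real.sqrt (a ^ 2 + k) + k * Real.log (a + Real.sqrt (a ^ 2 + k))) / 2 :=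
  intervalIntegral.integral_eq_sub_of_hasDerivAt
    (fun u _ => hasDerivAt_sqrt_sq_add_primitive hk u)
    (Continuous.intervalIntegrable (by fun_prop) _ _)

/-- Closed form for `∫₀¹ |2t·r₁ − r₂| dt` (Euclidean norm) when `r₁ × r₂ ≠ 0`,
where `cos θ = (r₁·r₂)/(|r₁||r₂|)`, `sin²θ = 1 − cos²θ`, and
`ρ = √(4|r₁|² − 4|r₁||r₂|cos θ + |r₂|²)`. -/
theorem integral_norm_linear_combination
    (r₁ r₂ : ℝ × ℝ)
    (hcross : r₁.1 * r₂.2 - r₁.2 * r₂.1 ≠ 0)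
    (n₁ n₂ cosθ sin2θ ρ : ℝ)
    (hn₁ : n₁ = Real.sqrt (r₁.1 ^ 2 + r₁.2 ^ 2))
    (hn₂ : n₂ = Real.sqrt (r₂.1 ^ 2 + r₂.2 ^ 2))
    (hcos : cosθ = (r₁.1 * r₂.1 + r₁.2 * r₂.2) / (n₁ * n₂))
    (hsin2 : sin2θ = 1 - cosθ ^ 2)
    (hρ : ρ = Real.sqrt (4 * n₁ ^ 2 - 4 * n₁ * n₂ * cosθ + n₂ ^ 2)) :
    ∫ t in (0 : ℝ)..1,
        Real.sqrt ((2 * t * r₁.1 - r₂.1) ^ 2 + (2 * t * r₁.2 - r₂.2) ^ 2) =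
      (1 / (4 * n₁)) *
        (n₂ ^ 2 * cosθ + (2 * n₁ - n₂ * cosθ) * ρ +
          n₂ ^ 2 * sin2θ * Real.log ((2 * n₁ - n₂ * cosθ + ρ) / (n₂ * (1 - cosθ)))) := by
  obtain ⟨x₁, y₁⟩ := r₁
  obtain ⟨x₂, y₂⟩ := r₂
  simp only at *
  have hcross2 : 0 < (x₁ * y₂ - y₁ * x₂) ^ 2 := by positivity
  have hq₁ : 0 < x₁ ^ 2 + y₁ ^ 2 := by
    by_contra! h
    have hx : x₁ = 0 := by nlinarith [sq_nonneg x₁, sq_nonneg y₁]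
    have hy : y₁ = 0 := by nlinarith [sq_nonneg x₁, sq_nonneg y₁]
    simp [hx, hy] at hcross
  have hq₂ : 0 < x₂ ^ 2 + y₂ ^ 2 := by
    by_contra! h
    have hx : x₂ = 0 := by nlinarith [sq_nonneg x₂, sq_nonneg y₂]
    have hy : y₂ = 0 := by nlinarith [sq_nonneg x₂, sq_nonneg y₂]
    simp [hx, hy] at hcross
  have hp₁ : 0 < n₁ := hn₁ ▸ Real.sqrt_pos.2 hq₁
  have hp₂ : 0 < n₂ := hn₂ ▸ Real.sqrt_pos.2 hq₂
  have hs₁ : n₁ ^ 2 = x₁ ^ 2 + y₁ ^ 2 := hn₁ ▸ Real.sq_sqrt hq₁.le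
  have hs₂ : n₂ ^ 2 = x₂ ^ 2 + y₂ ^ 2 := hn₂ ▸ Real.sq_sqrt hq₂.le
  have hdot : n₁ * n₂ * cosθ = x₁ * x₂ + y₁ * y₂ := by
    rw [hcos]
    field_simp
  have hsin : 0 < sin2θ := by
    have h : n₁ ^ 2 * n₂ ^ 2 * sin2θ = (x₁ * y₂ - y₁ * x₂) ^ 2 := by
      calc n₁ ^ 2 * n₂ ^ 2 * sin2θ = n₁ ^ 2 * n₂ ^ 2 - (n₁ * n₂ * cosθ) ^ 2 := by
            rw [hsin2]
            ring
        _ = (x₁ * y₂ - y₁ * x₂) ^ 2 := by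
            rw [hdot, hs₁, hs₂]
            ring
    exact pos_of_mul_pos_right (h ▸ hcross2) (by positivity)
  have hk : 0 < n₂ ^ 2 * sin2θ := by positivity
  have hint : ∀ t : ℝ, Real.sqrt ((2 * t * x₁ - x₂) ^ 2 + (2 * t * y₁ - y₂) ^ 2) =
      Real.sqrt ((2 * n₁ * t - n₂ * cosθ) ^ 2 + n₂ ^ 2 * sin2θ) := by
    intro t
    congr 1
    rw [hsin2]
    linear_combination (-4 * t ^ 2) * hs₁ - hs₂ + 4 * t * hdot
  have hsub : ∫ t in (0 : ℝ)..1, Real.sqrt ((2 * n₁ * t - n₂ * cosθ) ^ 2 + n₂ ^ 2 * sin2θ) =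
      (2 * n₁)⁻¹ * ∫ u in (-(n₂ * cosθ))..(2 * n₁ - n₂ * cosθ),
        Real.sqrt (u ^ 2 + n₂ ^ 2 * sin2θ) := by
    have h := intervalIntegral.integral_comp_mul_sub (a := 0) (b := 1)
      (fun u : ℝ => Real.sqrt (u ^ 2 + n₂ ^ 2 * sin2θ))
      (mul_pos two_pos hp₁).ne' (n₂ * cosθ)
    simpa using h
  have hleft : Real.sqrt ((-(n₂ * cosθ)) ^ 2 + n₂ ^ 2 * sin2θ) = n₂ := by
    rw [show (-(n₂ * cosθ)) ^ 2 + n₂ ^ 2 * sin2θ = n₂ ^ 2 by rw [hsin2]; ring,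
      Real.sqrt_sq hp₂.le]
  have hright : Real.sqrt ((2 * n₁ - n₂ * cosθ) ^ 2 + n₂ ^ 2 * sin2θ) = ρ := by
    rw [hρ, hsin2]
    congr 1
    ring
  have hposl := add_sqrt_sq_add_pos hk (-(n₂ * cosθ))
  have hposr := add_sqrt_sq_add_pos hk (2 * n₁ - n₂ * cosθ)
  rw [hleft] at hposl
  rw [hright] at hposr
  have hl : -(n₂ * cosθ) + n₂ = n₂ * (1 - cosθ) := by ring
  rw [hl] at hposl
  simp_rw [hint]
  rw [hsub, integral_sqrt_sq_add hk, hleft, hright, hl,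
    Real.log_div hposr.ne' hposl.ne']
  field_simp
  ring
end
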